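/- For every associative unital ℂ-algebra A, one has M_2(A)·M_3(A) ⊆ M_4(A); that is, the pair (2,3) is null. -/

import Mathlib

noncomputable section

/-- `lcs k A n` is the `(n+1)`-st term `L_{n+1}(A)` of the lower central series of `A`
regarded as a Lie algebra under the commutator `[a,b] = a*b - b*a`:
`lcs k A 0 = L_1(A) = A` and `L_{n+2}(A) = span [A, L_{n+1}(A)]`. -/
def lcs (k A : Type*) [Field k] [Ring A] [Algebra k A] : ℕ → Submodule k A
  | 0 => ⊤
  | n + 1 => Submodule.span k {x | ∃ a : A, ∃ b ∈ lcs k A n, x = a * b - b * a}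

/-- `Lser k A i = L_i(A)` for `i ≥ 1`. -/
def Lser (k A : Type*) [Field k] [Ring A] [Algebra k A] (i : ℕ) : Submodule k A :=
  lcs k A (i - 1)

/-- The two-sided ideal of `A` generated by a set `S`, as a `k`-submodule. -/
def idealGen (k : Type*) {A : Type*} [Field k] [Ring A] [Algebra k A] (S : Set A) :
    Submodule k A :=
  Submodule.span k {x | ∃ a b : A, ∃ s ∈ S, x = a * s * b}

/-- `Mser k A i = M_i(A)`, the two-sided ideal of `A` generated by `L_i(A)`. -/
def Mser (k A : Type*) [Field k] [Ring A] [Algebra k A] (i : ℕ) : Submodule k A :=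
  idealGen k (Lser k A i : Set A)

theorem lie_lie_swap {R : Type*} [Ring R] (w x y : R) : ⁅w, ⁅x, y⁆⁆ = -⁅w, ⁅y, x⁆⁆ := by
  simp only [Ring.lie_def]
  noncomm_ring

/-- In a ring whose triple commutators are central, `[z,w][t,[x,y]]` is antisymmetric in `z, t`. -/
theorem lie_mul_lie_lie_swap {R : Type*} [Ring R]
    (h : ∀ a b c d : R, ⁅a, ⁅b, ⁅c, d⁆⁆⁆ = 0) (z w t x y : R) :
    ⁅z, w⁆ * ⁅t, ⁅x, y⁆⁆ = -(⁅t, w⁆ * ⁅z, ⁅x, y⁆⁆) := by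
  have h₁ := h w (z * t) x y
  have h₂ := h w t x y
  have h₃ := h w z x y
  have h₄ := h ⁅t, w⁆ z x y
  generalize ⁅x, y⁆ = q at *
  have e : ⁅w, ⁅z * t, q⁆⁆ = -(⁅z, w⁆ * ⁅t, q⁆ + ⁅t, w⁆ * ⁅z, q⁆) + z * ⁅w, ⁅t, q⁆⁆
      + ⁅w, ⁅z, q⁆⁆ * t + ⁅⁅t, w⁆, ⁅z, q⁆⁆ := by
    simp only [Ring.lie_def]
    noncomm_ring
  rw [h₁, h₂, h₃, h₄, mul_zero, zero_mul, add_zero, add_zero, add_zero, eq_comm,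
    neg_eq_zero] at e
  exact eq_neg_of_add_eq_zero_left e

/-- In a ring whose triple commutators are central, `[v,y][w,[x,t]]` is antisymmetric in `v, x`. -/
theorem lie_mul_lie_lie_swap_inner {R : Type*} [Ring R]
    (h : ∀ a b c d : R, ⁅a, ⁅b, ⁅c, d⁆⁆⁆ = 0) (v y w x t : R) :
    ⁅v, y⁆ * ⁅w, ⁅x, t⁆⁆ = -(⁅x, y⁆ * ⁅w, ⁅v, t⁆⁆) := by
  have h₁ := h w t (x * v) y
  have e : ⁅w, ⁅t, ⁅x * v, y⁆⁆⁆ =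
      (⁅v, y⁆ * ⁅w, ⁅t, x⁆⁆ + ⁅w, ⁅t, x⁆⁆ * ⁅v, y⁆ - ⁅v, y⁆ * ⁅w, ⁅t, x⁆⁆)
      + ⁅x, y⁆ * ⁅w, ⁅t, v⁆⁆
      + (⁅t, x⁆ * ⁅w, ⁅v, y⁆⁆ + ⁅w, x⁆ * ⁅t, ⁅v, y⁆⁆)
      + (⁅t, ⁅x, y⁆⁆ * ⁅w, v⁆ + ⁅w, ⁅x, y⁆⁆ * ⁅t, v⁆)
      + x * ⁅w, ⁅t, ⁅v, y⁆⁆⁆ + ⁅w, ⁅t, ⁅x, y⁆⁆⁆ * v := by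
    simp only [Ring.lie_def]
    noncomm_ring
  have comm (a b c d f : R) : ⁅a, ⁅b, c⁆⁆ * ⁅d, f⁆ = ⁅d, f⁆ * ⁅a, ⁅b, c⁆⁆ := by
    have := h ⁅d, f⁆ a b c
    rw [Ring.lie_def, sub_eq_zero] at this
    exact this.symm
  have s₁ : ⁅t, x⁆ * ⁅w, ⁅v, y⁆⁆ + ⁅w, x⁆ * ⁅t, ⁅v, y⁆⁆ = 0 := by
    rw [lie_mul_lie_lie_swap h, neg_add_cancel]
  have s₂ : ⁅w, v⁆ * ⁅t, ⁅x, y⁆⁆ + ⁅t, v⁆ * ⁅w, ⁅x, y⁆⁆ = 0 := by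
    rw [lie_mul_lie_lie_swap h, neg_add_cancel]
  rw [h₁, h, h, comm, comm, comm, s₁, s₂, mul_zero, zero_mul, add_sub_cancel_right] at e
  simp only [add_zero] at e
  rw [lie_lie_swap w t x, lie_lie_swap w t v, mul_neg, mul_neg, ← neg_add, eq_comm, neg_eq_zero] at e
  exact eq_neg_of_add_eq_zero_left e

/-- In a ring whose triple commutators are central, `3 [z,w][t,[x,y]] = 0`. -/
theorem three_nsmul_lie_mul_lie_lie {R : Type*} [Ring R]
    (h : ∀ a b c d : R, ⁅a, ⁅b, ⁅c, d⁆⁆⁆ = 0) (z w t x y : R) :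
    3 • (⁅z, w⁆ * ⁅t, ⁅x, y⁆⁆) = 0 := by
  have swap (z w t x y : R) : ⁅z, w⁆ * ⁅t, ⁅x, y⁆⁆ = -(⁅z, w⁆ * ⁅x, ⁅t, y⁆⁆) := by
    rw [lie_mul_lie_lie_swap h z, lie_mul_lie_lie_swap_inner h t, lie_mul_lie_lie_swap h x,
      neg_neg]
  have skew (z w t x y : R) : ⁅z, w⁆ * ⁅t, ⁅x, y⁆⁆ = -(⁅z, w⁆ * ⁅t, ⁅y, x⁆⁆) := by
    rw [lie_lie_swap t x y, mul_neg]
  have jacobi : ⁅t, ⁅x, y⁆⁆ + ⁅x, ⁅y, t⁆⁆ + ⁅y, ⁅t, x⁆⁆ = 0 := by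
    simp only [Ring.lie_def]
    noncomm_ring
  have j := congrArg (⁅z, w⁆ * ·) jacobi
  simp only [mul_add, mul_zero] at j
  have e₁ : ⁅z, w⁆ * ⁅x, ⁅y, t⁆⁆ = ⁅z, w⁆ * ⁅t, ⁅x, y⁆⁆ := by
    rw [skew, swap, neg_neg]
  have e₂ : ⁅z, w⁆ * ⁅y, ⁅t, x⁆⁆ = ⁅z, w⁆ * ⁅t, ⁅x, y⁆⁆ := by
    rw [swap, skew, neg_neg]
  rw [e₁, e₂] at j
  rw [← j]
  abel

theorem TwoSidedIdeal.three_nsmul_lie_mul_lie_lie_mem {R : Type*} [Ring R] (I : TwoSidedIdeal R)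
    (h : ∀ a b c d : R, ⁅a, ⁅b, ⁅c, d⁆⁆⁆ ∈ I) (z w t x y : R) :
    3 • (⁅z, w⁆ * ⁅t, ⁅x, y⁆⁆) ∈ I := by
  have hlie (a b : R) : I.ringCon.mk' ⁅a, b⁆ = ⁅I.ringCon.mk' a, I.ringCon.mk' b⁆ := by
    simp only [Ring.lie_def, map_sub, map_mul]
  have hmem (a : R) : a ∈ I ↔ I.ringCon.mk' a = 0 := by
    rw [← TwoSidedIdeal.mem_ker, TwoSidedIdeal.ker_ringCon_mk']
  rw [hmem, map_nsmul, map_mul, hlie, hlie, hlie]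
  apply three_nsmul_lie_mul_lie_lie
  intro a b c d
  obtain ⟨a, rfl⟩ := I.ringCon.mk'_surjective a
  obtain ⟨b, rfl⟩ := I.ringCon.mk'_surjective b
  obtain ⟨c, rfl⟩ := I.ringCon.mk'_surjective c
  obtain ⟨d, rfl⟩ := I.ringCon.mk'_surjective d
  rw [← hlie, ← hlie, ← hlie, ← hmem]
  exact h a b c d

section

variable {k A : Type*} [Field k] [Ring A] [Algebra k A]

theorem lie_mem_lcs_succ {n : ℕ} (a : A) {b : A} (hb : b ∈ lcs k A n) :
    ⁅a, b⁆ ∈ lcs k A (n + 1) :=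
  Submodule.subset_span ⟨a, b, hb, rfl⟩

theorem lcs_succ_le {n : ℕ} {P : Submodule k A} (h : ∀ a : A, ∀ b ∈ lcs k A n, ⁅a, b⁆ ∈ P) :
    lcs k A (n + 1) ≤ P :=
  Submodule.span_le.2 <| by
    rintro _ ⟨a, b, hb, rfl⟩
    exact h a b hb

theorem subset_idealGen (S : Set A) : S ⊆ idealGen k S := fun s hs =>
  Submodule.subset_span ⟨1, 1, s, hs, by simp⟩

theorem mul_mem_idealGen_left {S : Set A} (c : A) {x : A} (hx : x ∈ idealGen k S) :
    c * x ∈ idealGen k S := by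
  suffices idealGen k S ≤ (idealGen k S).comap (LinearMap.mulLeft k c) from this hx
  refine Submodule.span_le.2 ?_
  rintro _ ⟨a, b, s, hs, rfl⟩
  exact Submodule.subset_span ⟨c * a, b, s, hs, by simp [mul_assoc]⟩

theorem mul_mem_idealGen_right {S : Set A} (c : A) {x : A} (hx : x ∈ idealGen k S) :
    x * c ∈ idealGen k S := by
  suffices idealGen k S ≤ (idealGen k S).comap (LinearMap.mulRight k c) from this hx
  refine Submodule.span_le.2 ?_
  rintro _ ⟨a, b, s, hs, rfl⟩
  exact Submodule.subset_span ⟨a, b * c, s, hs, by simp [mul_assoc]⟩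

theorem lie_mul_lie_lie_mem_idealGen (h3 : (3 : k) ≠ 0) (z w t x y : A) :
    ⁅z, w⁆ * ⁅t, ⁅x, y⁆⁆ ∈ idealGen k (lcs k A 3 : Set A) := by
  let I : TwoSidedIdeal A := TwoSidedIdeal.mk' (idealGen k (lcs k A 3 : Set A))
    (zero_mem _) add_mem neg_mem (mul_mem_idealGen_left _) (mul_mem_idealGen_right _)
  have hI (a : A) : a ∈ I ↔ a ∈ idealGen k (lcs k A 3 : Set A) := TwoSidedIdeal.mem_mk' ..
  have h := I.three_nsmul_lie_mul_lie_lie_mem (fun a b c d => (hI _).2 <| subset_idealGen _ <|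
    lie_mem_lcs_succ a <| lie_mem_lcs_succ b <| lie_mem_lcs_succ c
      (Submodule.mem_top : d ∈ lcs k A 0)) z w t x y
  rw [hI, ← Nat.cast_smul_eq_nsmul k] at h
  exact (Submodule.smul_mem_iff _ (by exact_mod_cast h3)).1 h

theorem lcs_one_mul_lcs_two_le (h3 : (3 : k) ≠ 0) :
    lcs k A 1 * lcs k A 2 ≤ idealGen k (lcs k A 3 : Set A) := by
  refine Submodule.mul_le.2 fun m hm n hn => ?_
  refine lcs_succ_le (P := (idealGen k _).comap (LinearMap.mulRight k n)) (fun z w _ => ?_) hm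
  refine lcs_succ_le (P := (idealGen k _).comap (LinearMap.mulLeft k ⁅z, w⁆))
    (fun t q hq => ?_) hn
  refine lcs_succ_le (P := (idealGen k _).comap
    (LinearMap.mulLeft k ⁅z, w⁆ ∘ₗ (LinearMap.mulLeft k t - LinearMap.mulRight k t))) (fun x y _ => ?_) hq
  exact lie_mul_lie_lie_mem_idealGen h3 z w t x y

theorem Mser_two_mul_Mser_three_le (h3 : (3 : k) ≠ 0) :
    Mser k A 2 * Mser k A 3 ≤ Mser k A 4 := by
  rw [Mser, Mser, idealGen, idealGen, Submodule.span_mul_span, Submodule.span_le]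
  rintro _ ⟨_, ⟨a, b, m, hm, rfl⟩, _, ⟨c, d, n, hn, rfl⟩, rfl⟩
  have e : a * m * b * (c * n * d) = a * (m * n) * (b * c * d) + a * m * ⁅b * c, n⁆ * d := by
    simp only [Ring.lie_def]
    noncomm_ring
  simp only [e]
  exact add_mem
    (mul_mem_idealGen_right _ <| mul_mem_idealGen_left _ <|
      lcs_one_mul_lcs_two_le h3 <| Submodule.mul_mem_mul hm hn)
    (mul_mem_idealGen_right _ <| mul_mem_idealGen_left _ <|
      subset_idealGen _ <| lie_mem_lcs_succ _ hn)

end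

/-- For every associative unital `ℂ`-algebra `A`, one has `M_2(A) · M_3(A) ⊆ M_4(A)`;
that is, the pair (2, 3) is null. -/
theorem Mser_2_mul_Mser_3 (A : Type*) [Ring A] [Algebra ℂ A] :
    Mser ℂ A 2 * Mser ℂ A 3 ≤ Mser ℂ A 4 := by
  exact Mser_two_mul_Mser_three_le three_ne_zero
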